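/- arXiv:2605.01175 — 2 statements merged into one kernel-verified Lean document; each statement's English description precedes it below -/
import Mathlib

section
/- Let 𝒢 be an ample groupoid and S an inverse semigroup of compact bisections of 𝒢 such that ⋃S = 𝒢. If S is generated as an inverse semigroup by a finite subset, then the unit space 𝒢⁰ is compact. -/
universe u

/-- The algebraic operations of a groupoid (identified with its set of arrows):
a (partially meaningful) composition `gmul` and an inversion `ginv`.  The product
`gmul g h` is only required to behave like composition when `g` and `h` are
composable, i.e. when `src g = rng h`. -/
class GroupoidOps (G : Type u) where
  gmul : G → G → G
  ginv : G → G

namespace GroupoidOps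

variable {G : Type u} [GroupoidOps G]

/-- The source map `s g = g⁻¹ g`. -/
def src (g : G) : G := gmul (ginv g) g

/-- The range map `r g = g g⁻¹`. -/
def rng (g : G) : G := gmul g (ginv g)

/-- The unit space `𝒢⁰`: the set of identity arrows. -/
def unitSpace (G : Type u) [GroupoidOps G] : Set G := {x : G | src x = x}

end GroupoidOps

open GroupoidOps

/-- A topological groupoid: a groupoid `G`, identified with its arrow space, equipped
with a topology such that inversion is continuous and composition is continuous on the
set of composable pairs. -/
class TopologicalGroupoid (G : Type u) extends TopologicalSpace G, GroupoidOps G where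
  ginv_ginv : ∀ g : G, ginv (ginv g) = g
  gmul_src : ∀ g : G, gmul g (src g) = g
  rng_gmul : ∀ g : G, gmul (rng g) g = g
  gmul_assoc : ∀ g h k : G, src g = rng h → src h = rng k →
    gmul (gmul g h) k = gmul g (gmul h k)
  src_gmul : ∀ g h : G, src g = rng h → src (gmul g h) = src h
  rng_gmul_comp : ∀ g h : G, src g = rng h → rng (gmul g h) = rng g
  ginv_gmul : ∀ g h : G, src g = rng h → ginv (gmul g h) = gmul (ginv h) (ginv g)
  ginv_unit : ∀ x : G, src x = x → ginv x = x
  src_src : ∀ g : G, src (src g) = src g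
  src_rng : ∀ g : G, src (rng g) = rng g
  continuous_ginv : Continuous (ginv : G → G)
  continuous_gmul : Continuous fun p : {p : G × G // src p.1 = rng p.2} => gmul p.1.1 p.1.2

/-- An ample groupoid: a topological groupoid (not necessarily Hausdorff) whose unit
space is locally compact, Hausdorff and totally disconnected in the subspace topology,
and whose source map, viewed as a map `G → 𝒢⁰`, is a local homeomorphism. -/
class AmpleGroupoid (G : Type u) extends TopologicalGroupoid G where
  t2_unitSpace : T2Space (unitSpace G)
  locallyCompact_unitSpace : LocallyCompactSpace (unitSpace G)
  totallyDisconnected_unitSpace : TotallyDisconnectedSpace (unitSpace G)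
  isLocalHomeomorph_src :
    IsLocalHomeomorph fun g : G => (⟨src g, TopologicalGroupoid.src_src g⟩ : unitSpace G)

namespace TopologicalGroupoid

variable {G : Type u} [TopologicalGroupoid G]

/-- A bisection: an open subset on which both the source and the range map are injective. -/
def IsBisection (U : Set G) : Prop :=
  IsOpen U ∧ Set.InjOn (src : G → G) U ∧ Set.InjOn (rng : G → G) U

/-- A compact bisection: a bisection which is compact
(quasi-compact and Hausdorff in the subspace topology). -/
def IsCompactBisection (U : Set G) : Prop :=
  IsBisection U ∧ IsCompact U ∧ T2Space U

/-- Setwise inverse `U⁻¹ = { u⁻¹ : u ∈ U }`. -/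
def setInv (U : Set G) : Set G := ginv '' U

/-- Setwise product `UV = { uv : u ∈ U, v ∈ V, s(u) = r(v) }`. -/
def setMul (U V : Set G) : Set G :=
  {x : G | ∃ u ∈ U, ∃ v ∈ V, src u = rng v ∧ x = gmul u v}

/-- A subgroupoid: a subset closed under inversion and (composable) composition. -/
def IsSubgroupoid (H : Set G) : Prop :=
  (∀ g ∈ H, ginv g ∈ H) ∧ ∀ g ∈ H, ∀ h ∈ H, src g = rng h → gmul g h ∈ H

/-- A groupoid is principal if every isotropy element is a unit. -/
def IsPrincipal (G : Type u) [TopologicalGroupoid G] : Prop :=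
  ∀ g : G, src g = rng g → g ∈ unitSpace G

/-- The orbit of `x`, namely `r(s⁻¹(x))`. -/
def orbit (x : G) : Set G := {y : G | ∃ g : G, src g = x ∧ rng g = y}

/-- A subset of the unit space is invariant if it is a union of orbits. -/
def IsInvariant (U : Set G) : Prop := ∀ g : G, src g ∈ U → rng g ∈ U

/-- An inverse semigroup of compact bisections: a nonempty collection of compact
bisections closed under setwise product and setwise inverse. -/
def IsInvSemigroupOfCompactBisections (S : Set (Set G)) : Prop :=
  S.Nonempty ∧ (∀ U ∈ S, IsCompactBisection U) ∧
    (∀ U ∈ S, setInv U ∈ S) ∧ ∀ U ∈ S, ∀ V ∈ S, setMul U V ∈ S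

/-- The orbit equivalence relation `𝓡` on the unit space. -/
def orbitRel (G : Type u) [TopologicalGroupoid G] :
    unitSpace G → unitSpace G → Prop :=
  fun x y => ∃ g : G, src g = (x : G) ∧ rng g = (y : G)

end TopologicalGroupoid

open TopologicalGroupoid

namespace TopologicalGroupoid

theorem src_ginv {G : Type u} [TopologicalGroupoid G] (g : G) : src (ginv g) = rng g := by
  simp only [src, rng, ginv_ginv]

theorem rng_ginv {G : Type u} [TopologicalGroupoid G] (g : G) : rng (ginv g) = src g := by
  simp only [src, rng, ginv_ginv]

end TopologicalGroupoid

theorem AmpleGroupoid.continuous_src {G : Type u} [AmpleGroupoid G] :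
    Continuous (src : G → G) :=
  continuous_subtype_val.comp (AmpleGroupoid.isLocalHomeomorph_src (G := G)).continuous

theorem AmpleGroupoid.continuous_rng {G : Type u} [AmpleGroupoid G] :
    Continuous (rng : G → G) := by
  simpa only [Function.comp_def, src_ginv] using
    AmpleGroupoid.continuous_src.comp (continuous_ginv (G := G))

/-- Let `𝒢` be an ample groupoid and `S` an inverse semigroup of
compact bisections with `⋃ S = 𝒢`.  If `S` is generated as an inverse semigroup by a
finite subset `X` (i.e. `S` is the smallest set of compact bisections containing `X`
and closed under setwise product and inverse), then the unit space `𝒢⁰` is compact. -/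
theorem unitSpace_compact_of_finitely_generated (G : Type u) [AmpleGroupoid G]
    (S : Set (Set G)) (hS : IsInvSemigroupOfCompactBisections S)
    (hcover : ⋃₀ S = Set.univ)
    (X : Set (Set G)) (hXfin : X.Finite) (hXS : X ⊆ S)
    (hgen : ∀ S' : Set (Set G), X ⊆ S' → (∀ U ∈ S', setInv U ∈ S') →
      (∀ U ∈ S', ∀ V ∈ S', setMul U V ∈ S') → S ⊆ S') :
    IsCompact (unitSpace G) ∧ T2Space (unitSpace G) := by
  refine ⟨?_, AmpleGroupoid.t2_unitSpace⟩
  let K : Set G := ⋃ U ∈ X, (src '' U ∪ rng '' U)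
  have hK : IsCompact K := hXfin.isCompact_biUnion fun U hU =>
    have hc : IsCompact U := (hS.2.1 U (hXS hU)).2.1
    (hc.image AmpleGroupoid.continuous_src).union (hc.image AmpleGroupoid.continuous_rng)
  have hSK : S ⊆ {U | ∀ g ∈ U, src g ∈ K ∧ rng g ∈ K} := by
    refine hgen _ ?_ ?_ ?_
    · exact fun U hU g hg =>
        ⟨Set.mem_biUnion hU (Or.inl ⟨g, hg, rfl⟩), Set.mem_biUnion hU (Or.inr ⟨g, hg, rfl⟩)⟩
    · rintro U hU _ ⟨g, hg, rfl⟩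
      rw [src_ginv, rng_ginv]
      exact (hU g hg).symm
    · rintro U hU V hV _ ⟨u, hu, v, hv, huv, rfl⟩
      rw [src_gmul u v huv, rng_gmul_comp u v huv]
      exact ⟨(hV v hv).1, (hU u hu).2⟩
  have hunit : unitSpace G = K := by
    refine Set.Subset.antisymm (fun x hx => ?_) (Set.iUnion₂_subset fun U _ => ?_)
    · obtain ⟨U, hU, hxU⟩ : x ∈ ⋃₀ S := hcover ▸ Set.mem_univ x
      have hx' : src x = x := hx
      exact hx' ▸ (hSK hU x hxU).1
    · rintro _ (⟨g, -, rfl⟩ | ⟨g, -, rfl⟩)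
      exacts [src_src g, src_rng g]
  exact hunit ▸ hK
end

section
/- Let 𝒢 be an ample groupoid which is the union of a family of open subgroupoids directed under inclusion, each of which is an AF groupoid in the subspace topology. Then 𝒢 is an AF groupoid. -/
universe u

open GroupoidOps

open TopologicalGroupoid

/-- An ample groupoid is AF if it is the union of a directed family of compact open
principal subgroupoids. -/
def IsAF (G : Type u) [AmpleGroupoid G] : Prop :=
  ∃ 𝒟 : Set (Set G), DirectedOn (· ⊆ ·) 𝒟 ∧
    (∀ H ∈ 𝒟, IsOpen H ∧ IsSubgroupoid H ∧ IsCompact H ∧ T2Space H ∧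
      ∀ g ∈ H, src g = rng g → g ∈ unitSpace G) ∧
    ⋃₀ 𝒟 = Set.univ

/-- A quasi-compact set covered by a nonempty directed family of open sets is contained in
one of its members. -/
theorem IsCompact.exists_subset_of_directedOn_sUnion {X : Type*} [TopologicalSpace X] {C : Set X}
    (hC : IsCompact C) {S : Set (Set X)} (hne : S.Nonempty) (hS : DirectedOn (· ⊆ ·) S)
    (hopen : ∀ U ∈ S, IsOpen U) (hCS : C ⊆ ⋃₀ S) : ∃ U ∈ S, C ⊆ U := by
  have : Nonempty S := hne.to_subtype
  obtain ⟨U, hU⟩ := hC.elim_directed_cover (fun U : S => (U : Set X))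
    (fun U => hopen U U.2) (by rwa [← Set.sUnion_eq_iUnion]) hS.directed_val
  exact ⟨U, U.2, hU⟩

/-- A directed union of open AF subgroupoids of an ample groupoid
is AF.  (An open subgroupoid `H` is AF in the subspace topology iff it is the union of
a directed family of compact open principal subgroupoids contained in `H`.) -/
theorem directed_union_of_AF_is_AF (G : Type u) [AmpleGroupoid G]
    (𝒟 : Set (Set G)) (hdir : DirectedOn (· ⊆ ·) 𝒟)
    (hsub : ∀ H ∈ 𝒟, IsOpen H ∧ IsSubgroupoid H)
    (hAF : ∀ H ∈ 𝒟, ∃ ℰ : Set (Set G), DirectedOn (· ⊆ ·) ℰ ∧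
      (∀ K ∈ ℰ, K ⊆ H ∧ IsOpen K ∧ IsSubgroupoid K ∧ IsCompact K ∧ T2Space K ∧
        ∀ g ∈ K, src g = rng g → g ∈ unitSpace G) ∧
      ⋃₀ ℰ = H)
    (hcover : ⋃₀ 𝒟 = Set.univ) :
    IsAF G := by
  choose! ℰ hℰdir hℰ hℰcover using hAF
  refine ⟨⋃ H ∈ 𝒟, ℰ H, ?_, ?_, ?_⟩
  · intro K hK L hL
    simp only [Set.mem_iUnion, exists_prop] at hK hL ⊢
    obtain ⟨H, hH, hKH⟩ := hK
    obtain ⟨I, hI, hLI⟩ := hL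
    obtain ⟨J, hJ, hHJ, hIJ⟩ := hdir H hH I hI
    obtain ⟨hK', -, -, hKc, -⟩ := hℰ H hH K hKH
    obtain ⟨hL', -, -, hLc, -⟩ := hℰ I hI L hLI
    have hKL : K ∪ L ⊆ ⋃₀ ℰ J := by
      rw [hℰcover J hJ]
      exact Set.union_subset (hK'.trans hHJ) (hL'.trans hIJ)
    rcases (ℰ J).eq_empty_or_nonempty with h | h
    · rw [h, Set.sUnion_empty, Set.subset_empty_iff, Set.union_empty_iff] at hKL
      exact ⟨K, ⟨H, hH, hKH⟩, subset_rfl, hKL.2.trans_subset (Set.empty_subset K)⟩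
    · obtain ⟨M, hM, hKLM⟩ := (hKc.union hLc).exists_subset_of_directedOn_sUnion h
        (hℰdir J hJ) (fun U hU => (hℰ J hJ U hU).2.1) hKL
      exact ⟨M, ⟨J, hJ, hM⟩, Set.union_subset_iff.mp hKLM⟩
  · intro K hK
    simp only [Set.mem_iUnion, exists_prop] at hK
    obtain ⟨H, hH, hKH⟩ := hK
    exact (hℰ H hH K hKH).2
  · refine Set.eq_univ_of_forall fun g => ?_
    obtain ⟨H, hH, hgH⟩ := hcover.symm ▸ Set.mem_univ g
    rw [← hℰcover H hH] at hgH
    obtain ⟨K, hK, hgK⟩ := hgH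
    exact ⟨K, Set.mem_biUnion hH hK, hgK⟩
end
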